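/- Let g be a real semisimple Lie algebra and X ∈ g a nonzero nilpotent element (i.e., ad X is a nilpotent endomorphism of g). Then there exist H, Y ∈ g with [H, X] = 2X, [H, Y] = -2Y, and [X, Y] = H (Jacobson–Morozov theorem over ℝ). -/

import Mathlib

section Associative

variable {A : Type*} [Ring A]

lemma lie_iterate_mul_of_lie_lie_eq_zero {x z : A} (h : ⁅x, ⁅x, z⁆⁆ = 0) (a : A) (n : ℕ) :
    (fun y ↦ ⁅x, y⁆)^[n + 1] (z * a) =
      z * (fun y ↦ ⁅x, y⁆)^[n + 1] a + (n + 1 : ℕ) * (⁅x, z⁆ * (fun y ↦ ⁅x, y⁆)^[n] a) := by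
  have leib (b c : A) : ⁅x, b * c⁆ = ⁅x, b⁆ * c + b * ⁅x, c⁆ := by
    simp only [Ring.lie_def]; noncomm_ring
  induction n with
  | zero => simp [leib, add_comm]
  | succ n ih =>
    rw [Function.iterate_succ_apply', ih]
    have hn : ⁅x, ((n + 1 : ℕ) : A)⁆ = 0 := by
      rw [Ring.lie_def, (Nat.cast_commute (n + 1) x).eq, sub_self]
    have hs (m : ℕ) (b : A) : ⁅x, (fun y ↦ ⁅x, y⁆)^[m] b⁆ = (fun y ↦ ⁅x, y⁆)^[m + 1] b :=
      (Function.iterate_succ_apply' _ m b).symm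
    have add_lie_left (b c : A) : ⁅x, b + c⁆ = ⁅x, b⁆ + ⁅x, c⁆ := by
      simp only [Ring.lie_def]; noncomm_ring
    rw [add_lie_left, leib, leib, leib, h, hn, hs, hs]
    push_cast
    noncomm_ring

lemma lie_iterate_pow_of_lie_lie_eq_zero {x z : A} (h : ⁅x, ⁅x, z⁆⁆ = 0) (k : ℕ) :
    (fun y ↦ ⁅x, y⁆)^[k] (z ^ k) = (k.factorial : A) * ⁅x, z⁆ ^ k ∧
      (fun y ↦ ⁅x, y⁆)^[k + 1] (z ^ k) = 0 := by
  induction k with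
  | zero => simp [Ring.lie_def]
  | succ k ih =>
    have key := lie_iterate_mul_of_lie_lie_eq_zero h (z ^ k)
    have hc : Commute ⁅x, z⁆ (k.factorial : A) := (Nat.cast_commute _ _).symm
    constructor
    · rw [pow_succ', key, ih.1, ih.2, mul_zero, zero_add, Nat.factorial_succ, pow_succ' ⁅x, z⁆,
        ← mul_assoc ⁅x, z⁆, hc.eq, Nat.cast_mul]
      simp only [mul_assoc]
    · rw [pow_succ', key, ih.2, Function.iterate_succ_apply', ih.2]
      simp [Ring.lie_def]

/-- Jacobson's lemma: a commutator with a nilpotent element which commutes with that element is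
nilpotent. -/
lemma isNilpotent_lie_of_lie_lie_eq_zero {K : Type*} [Field K] [CharZero K] [Algebra K A]
    {x z : A} (hx : IsNilpotent x) (h : ⁅x, ⁅x, z⁆⁆ = 0) : IsNilpotent ⁅x, z⁆ := by
  obtain ⟨k, hk⟩ := LieAlgebra.ad_nilpotent_of_nilpotent (R := K) hx
  refine ⟨k, ?_⟩
  have h0 : (fun y ↦ ⁅x, y⁆)^[k] (z ^ k) = 0 := by
    have := LinearMap.congr_fun hk (z ^ k)
    rwa [Module.End.pow_apply] at this
  rw [(lie_iterate_pow_of_lie_lie_eq_zero h k).1] at h0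
  have hf : (k.factorial : K) ≠ 0 := by exact_mod_cast k.factorial_ne_zero
  rw [← map_natCast (algebraMap K A), ← Algebra.smul_def] at h0
  exact (smul_eq_zero.mp h0).resolve_left hf

lemma pow_succ_mul_sub_mul_pow_succ {a h w : A} (haw : a * w - w * a = h)
    (hha : h * a - a * h = 2 * a) (n : ℕ) :
    a ^ (n + 1) * w - w * a ^ (n + 1) = (n + 1 : ℕ) * ((h - n) * a ^ n) := by
  induction n with
  | zero => simpa using haw
  | succ n ih =>
    have h1 : a * h = (h - 2) * a := by rw [sub_mul, ← hha]; abel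
    have h2 : a * (n : A) = n * a := (Nat.cast_commute n a).eq.symm
    have h3 : a * ((n + 1 : ℕ) : A) = (n + 1 : ℕ) * a := (Nat.cast_commute _ a).eq.symm
    calc a ^ (n + 1 + 1) * w - w * a ^ (n + 1 + 1)
        = a * (a ^ (n + 1) * w - w * a ^ (n + 1)) + (a * w - w * a) * a ^ (n + 1) := by
          rw [pow_succ' a (n + 1)]; noncomm_ring
      _ = (n + 1 : ℕ) * ((h - 2 - n) * a ^ (n + 1)) + h * a ^ (n + 1) := by
          rw [ih, haw, ← mul_assoc, h3, mul_assoc, ← mul_assoc a, mul_sub, h1, h2, pow_succ' a n,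
            ← sub_mul, mul_assoc _ a]
      _ = _ := by
          push_cast
          have h4 : h * (n : A) = n * h := (Nat.cast_commute n h).eq.symm
          noncomm_ring

end Associative

section Linear

variable {K V : Type*} [Field K] [CharZero K] [AddCommGroup V] [Module K V] [FiniteDimensional K V]

open Module LinearMap

lemma trace_mul_eq_zero_of_lie_lie_eq_zero {x z : End K V} (hx : IsNilpotent x)
    (h : ⁅x, ⁅x, z⁆⁆ = 0) : trace K V (x * z) = 0 := by
  have hc := isNilpotent_lie_of_lie_lie_eq_zero (K := K) hx h
  have hcx : Commute x ⁅x, z⁆ := by rwa [commute_iff_lie_eq]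
  have hxz (n : ℕ) : x ^ (n + 1) * z = z * x ^ (n + 1) + (n + 1 : ℕ) * (⁅x, z⁆ * x ^ n) := by
    induction n with
    | zero => simp [Ring.lie_def]
    | succ n ih =>
      have h3 : x * ((n + 1 : ℕ) : End K V) = (n + 1 : ℕ) * x := (Nat.cast_commute _ x).eq.symm
      calc x ^ (n + 1 + 1) * z = x * (x ^ (n + 1) * z) := by rw [pow_succ' x (n + 1), mul_assoc]
        _ = x * z * x ^ (n + 1) + (n + 1 : ℕ) * (⁅x, z⁆ * x ^ (n + 1)) := by
          rw [ih, mul_add, ← mul_assoc x, ← mul_assoc x, h3, mul_assoc _ x, ← mul_assoc x ⁅x, z⁆,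
            hcx.eq, mul_assoc _ x, ← pow_succ']
        _ = _ := by
          have h4 : x * z = z * x + ⁅x, z⁆ := by rw [Ring.lie_def]; abel
          rw [h4, pow_succ' x (n + 1)]
          push_cast
          noncomm_ring
  -- `x` lowers and `z` raises the filtration by the kernels of powers of `x`
  have mx (n : ℕ) : ∀ v ∈ ker (x ^ (n + 1)), x v ∈ ker (x ^ n) := fun v hv ↦ by
    rwa [mem_ker, ← Module.End.mul_apply, ← pow_succ]
  have le (n : ℕ) : ker (x ^ n) ≤ ker (x ^ (n + 1)) := fun v hv ↦ by
    rw [mem_ker] at hv ⊢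
    rw [pow_succ', Module.End.mul_apply, hv, map_zero]
  have mz (n : ℕ) : ∀ v ∈ ker (x ^ n), z v ∈ ker (x ^ (n + 1)) := fun v hv ↦ by
    have hv' := le n hv
    rw [mem_ker] at hv hv' ⊢
    rw [← Module.End.mul_apply, hxz]
    simp [hv, hv']
  have mc (n : ℕ) : ∀ v ∈ ker (x ^ n), ⁅x, z⁆ v ∈ ker (x ^ n) := fun v hv ↦ by
    rw [mem_ker] at hv ⊢
    rw [← Module.End.mul_apply, (hcx.pow_left n).eq, Module.End.mul_apply, hv, map_zero]
  have mxz (n : ℕ) : ∀ v ∈ ker (x ^ n), (x * z) v ∈ ker (x ^ n) :=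
    fun v hv ↦ mx n _ (mz n v hv)
  have key (n : ℕ) : trace K _ ((x * z).restrict (mxz n)) = 0 := by
    induction n with
    | zero =>
      have : Subsingleton (ker (x ^ 0)) := by
        rw [pow_zero, Module.End.one_eq_id, ker_id]; infer_instance
      rw [Subsingleton.elim ((x * z).restrict (mxz 0)) 0, map_zero]
    | succ n ih =>
      have e1 : (x * z).restrict (mxz (n + 1)) =
          z.restrict (mz n) ∘ₗ x.restrict (mx n) + ⁅x, z⁆.restrict (mc (n + 1)) := by
        ext v
        simp [Ring.lie_def]
      have e2 : (x * z).restrict (mxz n) = x.restrict (mx n) ∘ₗ z.restrict (mz n) := rfl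
      have e3 : IsNilpotent (⁅x, z⁆.restrict (mc (n + 1))) :=
        Module.End.isNilpotent.restrict (mc (n + 1)) hc
      rw [e1, map_add, trace_comp_comm', ← e2, ih, zero_add]
      exact (isNilpotent_trace_of_isNilpotent e3).eq_zero
  obtain ⟨N, hN⟩ := hx
  rw [← key N]
  have htop : ker (x ^ N) = ⊤ := by rw [hN, ker_zero]
  exact (trace_restrict_eq_of_forall_mem _ _ (fun v ↦ by rw [htop]; trivial) _).symm

end Linear

namespace LieAlgebra

variable {K L : Type*} [Field K] [CharZero K] [LieRing L] [LieAlgebra K L]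

lemma eq_zero_of_lie_eq_zero_of_lie_eq_neg_two_smul {x h w v : L} (hx : IsNilpotent (ad K L x))
    (hxw : ⁅x, w⁆ = h) (hhx : ⁅h, x⁆ = (2 : K) • x) (hxv : ⁅x, v⁆ = 0)
    (hhv : ⁅h, v⁆ = -((2 : K) • v)) : v = 0 := by
  have h1 : ad K L x * ad K L w - ad K L w * ad K L x = ad K L h := by
    ext u
    simp [← hxw]
  have h2 : ad K L h * ad K L x - ad K L x * ad K L h = 2 * ad K L x := by
    ext u
    have : ⁅⁅h, x⁆, u⁆ = (2 : K) • ⁅x, u⁆ := by rw [hhx, smul_lie]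
    simpa [lie_lie, two_smul, two_mul] using this
  have mem (n : ℕ) : ∃ u, (ad K L x ^ n) u = v := by
    induction n with
    | zero => exact ⟨v, rfl⟩
    | succ n ih =>
      obtain ⟨u, hu⟩ := ih
      have := LinearMap.congr_fun (pow_succ_mul_sub_mul_pow_succ h1 h2 n) u
      have hu' : (ad K L x ^ (n + 1)) u = 0 := by
        rw [pow_succ', Module.End.mul_apply, hu, ad_apply, hxv]
      have hne : (((n + 1 : ℕ) : K) * (-(2 + n))) ≠ 0 := by
        have : (2 + n : K) ≠ 0 := by exact_mod_cast (by omega : 2 + n ≠ 0)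
        exact mul_ne_zero (Nat.cast_ne_zero.mpr n.succ_ne_zero) (neg_ne_zero.mpr this)
      have e : (ad K L x ^ (n + 1)) ⁅w, u⁆ = (((n + 1 : ℕ) : K) * (-(2 + n))) • v := by
        simp only [LinearMap.sub_apply, Module.End.mul_apply, hu', hu, map_zero, sub_zero,
          ad_apply, hhv, Module.End.natCast_apply] at this
        rw [this]
        module
      refine ⟨(((n + 1 : ℕ) : K) * (-(2 + n)))⁻¹ • ⁅w, u⁆, ?_⟩
      rw [map_smul, e, inv_smul_smul₀ hne]
  obtain ⟨N, hN⟩ := hx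
  obtain ⟨u, hu⟩ := mem N
  rw [← hu, hN, LinearMap.zero_apply]

variable [FiniteDimensional K L]

lemma IsKilling.exists_lie_lie_eq_of_isNilpotent_ad [IsKilling K L] {x : L}
    (hx : IsNilpotent (ad K L x)) : ∃ w : L, ⁅x, ⁅x, w⁆⁆ = x := by
  suffices x ∈ LinearMap.range (ad K L x ∘ₗ ad K L x) by simpa using this
  rw [← LinearMap.BilinForm.orthogonal_orthogonal (IsKilling.killingForm_nondegenerate K L)
    (LieModule.traceForm_isSymm K L L).isRefl (LinearMap.range (ad K L x ∘ₗ ad K L x))]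
  intro z hz
  have hz0 : ⁅x, ⁅x, z⁆⁆ = 0 := by
    have : ⁅x, ⁅x, z⁆⁆ ∈ LinearMap.ker (killingForm K L) := by
      ext u
      have hu : killingForm K L ⁅x, ⁅x, u⁆⁆ z = 0 := hz _ ⟨u, rfl⟩
      rw [← lie_skew, map_neg, LinearMap.neg_apply, LieModule.traceForm_apply_lie_apply,
        ← lie_skew, map_neg, LinearMap.neg_apply, LieModule.traceForm_apply_lie_apply,
        neg_neg, LieModule.traceForm_comm] at hu
      exact hu
    simpa using this
  change killingForm K L z x = 0
  rw [LieModule.traceForm_comm]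
  refine trace_mul_eq_zero_of_lie_lie_eq_zero hx ?_
  have lie_ad (a b : L) : ⁅ad K L a, ad K L b⁆ = ad K L ⁅a, b⁆ := by
    ext u
    simp [Ring.lie_def]
  change ⁅ad K L x, ⁅ad K L x, ad K L z⁆⁆ = 0
  rw [lie_ad, lie_ad, hz0, map_zero]

/-- Morozov's lemma. -/
lemma exists_lie_eq_of_lie_eq_two_smul {x h w : L} (hx : IsNilpotent (ad K L x))
    (hxw : ⁅x, w⁆ = h) (hhx : ⁅h, x⁆ = (2 : K) • x) :
    ∃ y : L, ⁅h, y⁆ = -((2 : K) • y) ∧ ⁅x, y⁆ = h := by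
  have hxh : ⁅x, h⁆ = -((2 : K) • x) := by rw [← lie_skew, hhx]
  let T : Module.End K L := ad K L h + (2 : K) • LinearMap.id
  have hT (v : L) : T v = ⁅h, v⁆ + (2 : K) • v := rfl
  have maps : ∀ v ∈ LinearMap.ker (ad K L x), T v ∈ LinearMap.ker (ad K L x) := fun v hv ↦ by
    rw [LinearMap.mem_ker, ad_apply] at hv ⊢
    rw [hT, lie_add, lie_smul, leibniz_lie, hxh, hv]
    simp [hv]
  have inj : Function.Injective (T.restrict maps) := by
    rw [injective_iff_map_eq_zero]
    rintro ⟨v, hv⟩ h0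
    have h0' : T v = 0 := congrArg Subtype.val h0
    rw [hT] at h0'
    exact Subtype.ext (eq_zero_of_lie_eq_zero_of_lie_eq_neg_two_smul hx hxw hhx hv
      (eq_neg_of_add_eq_zero_left h0'))
  have hw : T w ∈ LinearMap.ker (ad K L x) := by
    rw [LinearMap.mem_ker, ad_apply, hT, lie_add, lie_smul, leibniz_lie, hxh, hxw]
    simp [hxw]
  obtain ⟨⟨u, hu⟩, huw⟩ := LinearMap.injective_iff_surjective.mp inj ⟨T w, hw⟩
  have huw' : T u = T w := congrArg Subtype.val huw
  refine ⟨w - u, eq_neg_of_add_eq_zero_left ?_, ?_⟩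
  · rw [← hT, map_sub, huw', sub_self]
  · rw [lie_sub, hxw, show ⁅x, u⁆ = 0 from hu, sub_zero]

/-- The **Jacobson–Morozov theorem** for Lie algebras with nondegenerate Killing form. -/
theorem IsKilling.exists_sl2_triple_of_isNilpotent_ad [IsKilling K L] {x : L}
    (hx : IsNilpotent (ad K L x)) :
    ∃ h y : L, ⁅h, x⁆ = (2 : K) • x ∧ ⁅h, y⁆ = -((2 : K) • y) ∧ ⁅x, y⁆ = h := by
  obtain ⟨w, hw⟩ := IsKilling.exists_lie_lie_eq_of_isNilpotent_ad hx
  have hhx : ⁅⁅x, -((2 : K) • w)⁆, x⁆ = (2 : K) • x := by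
    rw [← lie_skew, lie_neg, lie_neg, lie_smul, lie_smul, hw, neg_neg]
  obtain ⟨y, hy⟩ := exists_lie_eq_of_lie_eq_two_smul hx rfl hhx
  exact ⟨_, y, hhx, hy⟩

end LieAlgebra

/-- Jacobson–Morozov over ℝ: let `g` be a real semisimple Lie algebra (finite-dimensional with
nondegenerate Killing form) and `X ∈ g` a nonzero nilpotent element (i.e. `ad X` is a nilpotent
endomorphism of `g`).  Then there exist `H, Y ∈ g` with `[H, X] = 2X`, `[H, Y] = -2Y` and
`[X, Y] = H`. -/
theorem stmt12 (L : Type*) [LieRing L] [LieAlgebra ℝ L] [FiniteDimensional ℝ L]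
    [LieAlgebra.IsKilling ℝ L]
    (X : L) (hX : X ≠ 0) (hnil : IsNilpotent ((LieAlgebra.ad ℝ L) X)) :
    ∃ H Y : L, ⁅H, X⁆ = (2 : ℝ) • X ∧ ⁅H, Y⁆ = -((2 : ℝ) • Y) ∧ ⁅X, Y⁆ = H :=
  LieAlgebra.IsKilling.exists_sl2_triple_of_isNilpotent_ad hnil
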